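/- Necessity in the Carleson embedding theorem via reproducing kernel testing: under the hypotheses of the Carleson embedding theorem, if ∫_𝔻 ⟨G(z) f^{(n)}(z), f^{(n)}(z)⟩ dA(z) ≲ ∫_𝔻 ⟨W f, f⟩ dA_η for all f ∈ L²_a(H, W dA_η), then ∫_{D_{λ,r}} G dA ≲ (1−|λ|)^{2n} ∫_{D_{λ,r}} W dA_η uniformly in λ ∈ 𝔻. -/

import Mathlib

open MeasureTheory Metric Complex Set
open scoped ENNReal NNReal InnerProductSpace

noncomputable section

/-- Normalized Lebesgue area measure on the unit disc. -/
def areaM : Measure ℂ := (ENNReal.ofReal Real.pi)⁻¹ • (volume.restrict (ball (0:ℂ) 1))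

/-- The dyadic arc of level `n`, index `k` (half-open parametrization). -/
def dyadicArc (n k : ℕ) : Set ℂ :=
  {z | ∃ t : ℝ, 2 * Real.pi * k / 2 ^ n ≤ t ∧ t < 2 * Real.pi * (k + 1) / 2 ^ n ∧
    z = Complex.exp (t * Complex.I)}

/-- The Carleson square over the dyadic arc of level `n`, index `k`. -/
def carlesonBox (n k : ℕ) : Set ℂ :=
  {z | ‖z‖ < 1 ∧ (z / (‖z‖ : ℂ)) ∈ dyadicArc n k ∧ 1 - 1 / 2 ^ n ≤ ‖z‖}

/-- The top half of the Carleson square. -/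
def topHalf (n k : ℕ) : Set ℂ :=
  {z | z ∈ carlesonBox n k ∧ ‖z‖ < 1 - 1 / 2 ^ (n + 1)}

/-- The disc `D_{z,r}` of radius `r(1-|z|)` centered at `z`, inside the unit disc. -/
def discAt (z : ℂ) (r : ℝ) : Set ℂ :=
  {ζ : ℂ | ‖ζ‖ < 1 ∧ ‖ζ - z‖ < r * (1 - ‖z‖)}

variable {H : Type*} [NormedAddCommGroup H] [InnerProductSpace ℂ H] [CompleteSpace H]

/-- `T` is the weak (Pettis) integral of the operator-valued function `F` over `S`
with respect to `ν`. -/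
def IsWeakOpIntegral (ν : Measure ℂ) (F : ℂ → H →L[ℂ] H) (S : Set ℂ)
    (T : H →L[ℂ] H) : Prop :=
  ∀ x y : H, Integrable (fun z => (⟪F z x, y⟫_ℂ)) (ν.restrict S) ∧
    (⟪T x, y⟫_ℂ) = ∫ z in S, ⟪F z x, y⟫_ℂ ∂ν

/-- The weighted area measure `dA_η = (η+1)(1−|z|)^η dA`. -/
def measAeta (η : ℝ) : Measure ℂ :=
  areaM.withDensity fun z => ENNReal.ofReal ((η + 1) * (1 - ‖z‖) ^ η)

/-- A (non-dyadic) Carleson square `S = {ρ e^{it} : 1−h < ρ < 1, |t−θ| < πh}`. -/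
def carlesonSquare (h θ : ℝ) : Set ℂ :=
  {z | ∃ ρ t : ℝ, 1 - h < ρ ∧ ρ < 1 ∧ |t - θ| < Real.pi * h ∧
    z = (ρ : ℂ) * Complex.exp (t * Complex.I)}

/-- `W` (with pointwise inverse `Winv`) is an operator-valued Békollé–Bonami `B₂(η)`
weight: a.e. nonnegative and invertible, with `(1−|z|)^η W` and `(1−|z|)^η W⁻¹` weakly
integrable on `𝔻`, `∫ W dA_η` invertible, and the `B₂(η)` condition (formulated via the
positive square roots of the normalized averages over Carleson squares). -/
def IsB2Weight (η : ℝ) (W Winv : ℂ → H →L[ℂ] H) : Prop :=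
  (∀ᵐ z ∂areaM, (W z).IsPositive ∧ W z ∘L Winv z = 1 ∧ Winv z ∘L W z = 1) ∧
  (∃ TW : H →L[ℂ] H, IsWeakOpIntegral (measAeta η) W (ball (0 : ℂ) 1) TW ∧ IsUnit TW) ∧
  (∃ TWi : H →L[ℂ] H, IsWeakOpIntegral (measAeta η) Winv (ball (0 : ℂ) 1) TWi) ∧
  ∃ c : ℝ, ∀ h θ : ℝ, 0 < h → h < 1 → 0 ≤ θ → θ < 2 * Real.pi →
    ∀ P Q Ps Qs : H →L[ℂ] H,
      IsWeakOpIntegral (measAeta η) W (carlesonSquare h θ) P →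
      IsWeakOpIntegral (measAeta η) Winv (carlesonSquare h θ) Q →
      Ps.IsPositive → Qs.IsPositive →
      Ps ∘L Ps = ((measAeta η (carlesonSquare h θ)).toReal⁻¹) • P →
      Qs ∘L Qs = ((measAeta η (carlesonSquare h θ)).toReal⁻¹) • Q →
      ‖Ps ∘L Qs‖ ≤ c

lemma pos_sqrt {T : H →L[ℂ] H} (hT : T.IsPositive) :
    ∃ S : H →L[ℂ] H, S.IsPositive ∧ S ∘L S = T := by
  have h0 : 0 ≤ T := (ContinuousLinearMap.nonneg_iff_isPositive T).2 hT
  refine ⟨CFC.sqrt T, (ContinuousLinearMap.nonneg_iff_isPositive _).1 (CFC.sqrt_nonneg T), ?_⟩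
  exact CFC.sqrt_mul_sqrt_self T h0

lemma sqrt_inner {S : H →L[ℂ] H} (hS : S.IsPositive) (x y : H) :
    ⟪(S ∘L S) x, y⟫_ℂ = ⟪S x, S y⟫_ℂ := by
  exact hS.isSymmetric (S x) y

lemma sqrt_re {S : H →L[ℂ] H} (hS : S.IsPositive) (x : H) :
    (S ∘L S).reApplyInnerSelf x = ‖S x‖ ^ 2 := by
  rw [ContinuousLinearMap.reApplyInnerSelf_apply, sqrt_inner hS]
  exact inner_self_eq_norm_sq (𝕜 := ℂ) (S x)

lemma pos_amgm {T : H →L[ℂ] H} (hT : T.IsPositive) (x y : H) {t : ℝ} (ht : 0 < t) :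
    2 * ‖⟪T x, y⟫_ℂ‖ ≤ t * T.reApplyInnerSelf x + t⁻¹ * T.reApplyInnerSelf y := by
  obtain ⟨S, hS, rfl⟩ := pos_sqrt hT
  rw [sqrt_re hS, sqrt_re hS, sqrt_inner hS]
  have h1 := norm_inner_le_norm (𝕜 := ℂ) (S x) (S y)
  have h2 : 0 ≤ t⁻¹ * (t * ‖S x‖ - ‖S y‖) ^ 2 := by positivity
  have h3 : t⁻¹ * (t * ‖S x‖ - ‖S y‖) ^ 2
      = t * ‖S x‖ ^ 2 + t⁻¹ * ‖S y‖ ^ 2 - 2 * (‖S x‖ * ‖S y‖) := by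
    field_simp
    ring
  linarith

lemma inv_positive {T U : H →L[ℂ] H} (hT : T.IsPositive) (h : T ∘L U = 1) : U.IsPositive := by
  have h1 : ∀ x, T (U x) = x := fun x => by
    have := congrArg (fun A : H →L[ℂ] H => A x) h
    simpa using this
  rw [ContinuousLinearMap.isPositive_def']
  constructor
  · rw [ContinuousLinearMap.isSelfAdjoint_iff_isSymmetric]
    intro x y
    have := hT.isSymmetric (U x) (U y)
    simp only [ContinuousLinearMap.coe_coe, h1] at this
    exact this.symm
  · intro x
    have := hT.re_inner_nonneg_right (U x)
    rw [h1] at this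
    exact this

lemma pair_amgm {T U : H →L[ℂ] H} (hT : T.IsPositive) (h : T ∘L U = 1) (e x : H) {t : ℝ}
    (ht : 0 < t) :
    2 * ‖⟪e, x⟫_ℂ‖ ≤ t * T.reApplyInnerSelf e + t⁻¹ * U.reApplyInnerSelf x := by
  have h1 : T (U x) = x := by
    have := congrArg (fun A : H →L[ℂ] H => A x) h
    simpa using this
  have h2 := pos_amgm hT e (U x) ht
  have h3 : ⟪T e, U x⟫_ℂ = ⟪e, T (U x)⟫_ℂ := hT.isSymmetric e (U x)
  rw [h3, h1] at h2
  have h4 : T.reApplyInnerSelf (U x) = U.reApplyInnerSelf x := by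
    rw [ContinuousLinearMap.reApplyInnerSelf_apply, ContinuousLinearMap.reApplyInnerSelf_apply, h1]
    exact inner_re_symm (𝕜 := ℂ) x (U x)
  rwa [h4] at h2

lemma re_eq_of_weak {ν : Measure ℂ} {F : ℂ → H →L[ℂ] H} {S : Set ℂ} {T : H →L[ℂ] H}
    (h : IsWeakOpIntegral ν F S T) (x : H) :
    Integrable (fun z => (F z).reApplyInnerSelf x) (ν.restrict S) ∧
    T.reApplyInnerSelf x = ∫ z in S, (F z).reApplyInnerSelf x ∂ν := by
  obtain ⟨h1, h2⟩ := h x x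
  refine ⟨h1.re, ?_⟩
  rw [ContinuousLinearMap.reApplyInnerSelf_apply, h2]
  exact (integral_re h1).symm

lemma exists_weak {ν : Measure ℂ} {F : ℂ → H →L[ℂ] H} {T : H →L[ℂ] H}
    (hpos : ∀ᵐ z ∂ν, (F z).IsPositive) (hν : ν.restrict (ball (0:ℂ) 1) = ν)
    (hT : IsWeakOpIntegral ν F (ball (0:ℂ) 1) T) (S : Set ℂ) :
    ∃ P : H →L[ℂ] H, IsWeakOpIntegral ν F S P ∧ P.IsPositive := by
  have hWint : ∀ x y, Integrable (fun z => (⟪F z x, y⟫_ℂ)) ν := fun x y => by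
    have := (hT x y).1
    rwa [hν] at this
  have hWintS : ∀ x y, Integrable (fun z => (⟪F z x, y⟫_ℂ)) (ν.restrict S) := fun x y =>
    (hWint x y).restrict
  have hre : ∀ x, Integrable (fun z => (F z).reApplyInnerSelf x) ν := fun x => (hWint x x).re
  have hnn : ∀ x, 0 ≤ᵐ[ν] fun z => (F z).reApplyInnerSelf x := fun x => by
    filter_upwards [hpos] with z hz using hz.re_inner_nonneg_left x
  have hreT : ∀ x, ∫ z in S, (F z).reApplyInnerSelf x ∂ν ≤ ‖T‖ * ‖x‖ ^ 2 := fun x => by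
    have h1 := (re_eq_of_weak hT x).2
    rw [hν] at h1
    have h2 : T.reApplyInnerSelf x ≤ ‖T‖ * ‖x‖ ^ 2 := by
      rw [ContinuousLinearMap.reApplyInnerSelf_apply]
      refine (RCLike.re_le_norm _).trans ((norm_inner_le_norm _ _).trans ?_)
      have := T.le_opNorm x
      nlinarith [norm_nonneg x]
    refine le_trans ?_ h2
    rw [h1]
    exact setIntegral_le_integral (hre x) (hnn x)
  have key : ∀ x y (t : ℝ), 0 < t → 2 * ‖∫ z in S, ⟪F z x, y⟫_ℂ ∂ν‖
      ≤ t * (‖T‖ * ‖x‖ ^ 2) + t⁻¹ * (‖T‖ * ‖y‖ ^ 2) := fun x y t ht => by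
    have h1 : ‖∫ z in S, ⟪F z x, y⟫_ℂ ∂ν‖ ≤ ∫ z in S, ‖⟪F z x, y⟫_ℂ‖ ∂ν :=
      norm_integral_le_integral_norm _
    have h2 : ∫ z in S, 2 * ‖⟪F z x, y⟫_ℂ‖ ∂ν ≤ ∫ z in S, (t * (F z).reApplyInnerSelf x
        + t⁻¹ * (F z).reApplyInnerSelf y) ∂ν := by
      refine integral_mono_ae ((hWintS x y).norm.const_mul 2)
        (((hre x).restrict.const_mul t).add ((hre y).restrict.const_mul t⁻¹)) ?_
      filter_upwards [ae_restrict_of_ae hpos] with z hz using pos_amgm hz x y ht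
    rw [integral_add ((hre x).restrict.const_mul t) ((hre y).restrict.const_mul t⁻¹),
      integral_const_mul, integral_const_mul, integral_const_mul] at h2
    have h3 := mul_le_mul_of_nonneg_left (hreT x) ht.le
    have h4 := mul_le_mul_of_nonneg_left (hreT y) (inv_pos.2 ht).le
    linarith
  let B : H →ₗ⋆[ℂ] H →ₗ[ℂ] ℂ := LinearMap.mk₂'ₛₗ (starRingEnd ℂ) (RingHom.id ℂ)
    (fun x y => ∫ z in S, ⟪F z x, y⟫_ℂ ∂ν)
    (fun x x' y => by
      simp only [map_add, inner_add_left]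
      exact integral_add (hWintS x y) (hWintS x' y))
    (fun c x y => by
      simp only [map_smul, inner_smul_left]
      rw [integral_const_mul]; rfl)
    (fun x y y' => by
      simp only [inner_add_right]
      exact integral_add (hWintS x y) (hWintS x y'))
    (fun c x y => by
      simp only [inner_smul_right]
      rw [integral_const_mul]; rfl)
  have hB : ∀ x y, ‖B x y‖ ≤ ‖T‖ * ‖x‖ * ‖y‖ := fun x y => by
    rcases eq_or_ne x 0 with rfl | hx
    · simp
    rcases eq_or_ne y 0 with rfl | hy
    · simp
    have hx' := norm_pos_iff.2 hx
    have hy' := norm_pos_iff.2 hy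
    have := key x y (‖y‖ / ‖x‖) (by positivity)
    have e1 : ‖y‖ / ‖x‖ * (‖T‖ * ‖x‖ ^ 2) + (‖y‖ / ‖x‖)⁻¹ * (‖T‖ * ‖y‖ ^ 2)
      = 2 * (‖T‖ * ‖x‖ * ‖y‖) := by
      field_simp; ring
    rw [e1] at this
    change ‖∫ z in S, ⟪F z x, y⟫_ℂ ∂ν‖ ≤ _
    linarith
  let B' := LinearMap.mkContinuous₂ B ‖T‖ hB
  let P := InnerProductSpace.continuousLinearMapOfBilin B'
  have hP : IsWeakOpIntegral ν F S P := fun x y => by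
    refine ⟨hWintS x y, ?_⟩
    rw [InnerProductSpace.continuousLinearMapOfBilin_apply]
    rfl
  refine ⟨P, hP, ?_⟩
  rw [ContinuousLinearMap.isPositive_def']
  constructor
  · rw [ContinuousLinearMap.isSelfAdjoint_iff_isSymmetric]
    intro x y
    have h1 := (hP x y).2
    have h2 := (hP y x).2
    change ⟪P x, y⟫_ℂ = ⟪x, P y⟫_ℂ
    rw [← inner_conj_symm x (P y), h1, h2, ← integral_conj]
    refine integral_congr_ae ?_
    filter_upwards [ae_restrict_of_ae hpos] with z hz
    rw [inner_conj_symm]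
    exact hz.isSymmetric x y
  · intro x
    rw [(re_eq_of_weak hP x).2]
    exact integral_nonneg_of_ae (ae_restrict_of_ae (hnn x))
lemma measAeta_ac (η : ℝ) : measAeta η ≪ areaM := withDensity_absolutelyContinuous _ _

lemma areaM_ac : areaM ≪ (volume : Measure ℂ) := by
  unfold areaM
  exact (Measure.smul_absolutelyContinuous).trans Measure.absolutelyContinuous_restrict

instance areaM_fin : IsFiniteMeasure areaM := by
  unfold areaM
  have : IsFiniteMeasure ((volume : Measure ℂ).restrict (ball (0:ℂ) 1)) :=
    ⟨by simpa using measure_ball_lt_top⟩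
  refine ⟨?_⟩
  rw [Measure.smul_apply, smul_eq_mul]
  refine ENNReal.mul_lt_top ?_ (measure_lt_top _ _)
  simp [Real.pi_pos]

lemma areaM_ball : ∀ᵐ z ∂areaM, z ∈ ball (0:ℂ) 1 := by
  unfold areaM
  exact Measure.ae_smul_measure (ae_restrict_mem measurableSet_ball) _

lemma areaM_restrict : areaM.restrict (ball (0:ℂ) 1) = areaM :=
  Measure.restrict_eq_self_of_ae_mem areaM_ball

lemma measAeta_ball (η : ℝ) : ∀ᵐ z ∂(measAeta η), z ∈ ball (0:ℂ) 1 :=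
  (measAeta_ac η).ae_le areaM_ball

lemma measAeta_restrict (η : ℝ) : (measAeta η).restrict (ball (0:ℂ) 1) = measAeta η :=
  Measure.restrict_eq_self_of_ae_mem (measAeta_ball η)

instance measAeta_sf (η : ℝ) : SFinite (measAeta η) := by
  unfold measAeta; infer_instance

lemma measAeta_apply (η : ℝ) {s : Set ℂ} (hs : MeasurableSet s) (hsb : s ⊆ ball (0:ℂ) 1) :
    measAeta η s = (ENNReal.ofReal Real.pi)⁻¹ *
      ∫⁻ z in s, ENNReal.ofReal ((η + 1) * (1 - ‖z‖) ^ η) := by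
  unfold measAeta areaM
  rw [withDensity_apply _ hs, Measure.restrict_smul, lintegral_smul_measure,
    Measure.restrict_restrict hs, inter_eq_left.2 hsb, smul_eq_mul]

lemma radial_lintegral (η : ℝ) (hη : -1 < η) (h : ℝ) (h0 : 0 < h) :
    ∫⁻ x in Ioo (1 - h) 1, ENNReal.ofReal ((η + 1) * (1 - x) ^ η) = ENNReal.ofReal (h ^ (η + 1)) := by
  have h1 : IntervalIntegrable (fun x : ℝ => (η + 1) * (1 - x) ^ η) volume (1 - h) 1 := by
    have := (intervalIntegral.intervalIntegrable_rpow' (a := 0) (b := h) hη).comp_sub_left 1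
    simp only [sub_zero] at this
    exact (this.symm).const_mul _
  have h2 : ∫ x in (1 - h)..1, (η + 1) * (1 - x) ^ η = h ^ (η + 1) := by
    rw [intervalIntegral.integral_const_mul]
    rw [intervalIntegral.integral_comp_sub_left (fun x : ℝ => x ^ η) 1]
    rw [integral_rpow (Or.inl hη)]
    have : η + 1 ≠ 0 := by linarith
    simp only [sub_self, sub_sub_cancel, Real.zero_rpow this]
    field_simp
    ring
  rw [← h2, intervalIntegral.integral_of_le (by linarith),
    integral_Ioc_eq_integral_Ioo]
  rw [ofReal_integral_eq_lintegral_ofReal]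
  · rw [intervalIntegrable_iff_integrableOn_Ioo_of_le (by linarith)] at h1
    exact h1
  · filter_upwards [ae_restrict_mem measurableSet_Ioo] with x hx
    have : 0 ≤ 1 - x := by linarith [hx.2]
    have : 0 ≤ η + 1 := by linarith
    positivity

lemma square_measure (η : ℝ) (hη : -1 < η) (h : ℝ) (h0 : 0 < h) (h1 : h < 1) (θ : ℝ) :
    measAeta η (carlesonSquare h θ) ≤ ENNReal.ofReal (2 * h ^ (η + 2)) := by
  let d : ℂ → ℝ≥0∞ := fun z => ENNReal.ofReal ((η + 1) * (1 - ‖z‖) ^ η)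
  let S0 : Set ℂ := {z | (1 - h < ‖z‖ ∧ ‖z‖ < 1) ∧ |arg z| < Real.pi * h}
  have mS0 : MeasurableSet S0 := by
    refine MeasurableSet.inter (MeasurableSet.inter ?_ ?_) ?_
    · exact measurableSet_lt measurable_const measurable_norm
    · exact measurableSet_lt measurable_norm measurable_const
    · exact measurableSet_lt (measurable_arg.abs) measurable_const
  let a : Circle := Circle.exp (-θ)
  let S1 : Set ℂ := (rotation a) ⁻¹' S0
  have mS1 : MeasurableSet S1 := (rotation a).continuous.measurable mS0
  have hsub : carlesonSquare h θ ⊆ S1 := by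
    rintro z ⟨ρ, t, hρ, hρ1, ht, rfl⟩
    have hρ0 : 0 < ρ := by linarith
    have e1 : rotation a ((ρ : ℂ) * Complex.exp (t * I)) = (ρ : ℂ) * Complex.exp (((t - θ : ℝ) : ℂ) * I) := by
      rw [rotation_apply, Circle.coe_exp]
      rw [mul_left_comm, ← Complex.exp_add]
      congr 2
      push_cast
      ring
    change rotation a _ ∈ S0
    rw [e1]
    have hpi : Real.pi * h < Real.pi := by nlinarith [Real.pi_pos]
    obtain ⟨ht1, ht2⟩ := abs_lt.1 ht
    have e2 : arg ((ρ : ℂ) * Complex.exp (((t - θ : ℝ) : ℂ) * I)) = t - θ := by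
      rw [arg_real_mul _ hρ0, Complex.arg_exp_mul_I, toIocMod_eq_self]
      constructor <;> linarith
    have e3 : ‖(ρ : ℂ) * Complex.exp (((t - θ : ℝ) : ℂ) * I)‖ = ρ := by
      rw [norm_mul, Complex.norm_exp_ofReal_mul_I, mul_one, Complex.norm_real, Real.norm_of_nonneg hρ0.le]
    refine ⟨?_, ?_⟩
    · rw [e3]; exact ⟨hρ, hρ1⟩
    · rw [e2]; exact ht
  refine (measure_mono hsub).trans ?_
  rw [measAeta_apply η mS1 (fun z hz => by
    have : ‖rotation a z‖ < 1 := hz.1.2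
    rw [LinearIsometryEquiv.norm_map] at this
    simpa using this)]
  have e4 : ∫⁻ z in S1, d z = ∫⁻ z in S0, d z := by
    rw [← lintegral_indicator mS1, ← lintegral_indicator mS0,
      ← (LinearIsometryEquiv.measurePreserving (rotation a)).lintegral_comp_emb
        (rotation a).toHomeomorph.measurableEmbedding (S0.indicator d)]
    refine lintegral_congr fun z => ?_
    have : d z = d (rotation a z) := by simp only [d, LinearIsometryEquiv.norm_map]
    by_cases hz : rotation a z ∈ S0
    · rw [indicator_of_mem hz, indicator_of_mem (show z ∈ S1 from hz), this]
    · rw [indicator_of_notMem hz, indicator_of_notMem (show z ∉ S1 from hz)]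
  have e5 : ∫⁻ z in S0, d z ≤ ENNReal.ofReal (h ^ (η + 1)) * ENNReal.ofReal (2 * Real.pi * h) := by
    rw [← lintegral_indicator mS0, ← Complex.lintegral_comp_polarCoord_symm]
    let R : Set (ℝ × ℝ) := Ioo (1 - h) 1 ×ˢ Ioo (-(Real.pi * h)) (Real.pi * h)
    have mR : MeasurableSet R := measurableSet_Ioo.prod measurableSet_Ioo
    calc _ ≤ ∫⁻ p in polarCoord.target, R.indicator (fun p => ENNReal.ofReal ((η + 1) * (1 - p.1) ^ η) * 1) p := by
          refine setLIntegral_mono' polarCoord.open_target.measurableSet fun p hp => ?_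
          by_cases hz : Complex.polarCoord.symm p ∈ S0
          · have hpt : p ∈ Complex.polarCoord.target := by
              rw [Complex.polarCoord_target]; simpa [polarCoord] using hp
            have hri := Complex.polarCoord.right_inv hpt
            rw [Complex.polarCoord_apply] at hri
            have n1 : ‖Complex.polarCoord.symm p‖ = p.1 := congrArg Prod.fst hri
            have n2 : arg (Complex.polarCoord.symm p) = p.2 := congrArg Prod.snd hri
            have hpR : p ∈ R := by
              obtain ⟨h3, h4⟩ := hz
              rw [n1] at h3
              rw [n2] at h4
              exact ⟨h3, abs_lt.1 h4⟩
            rw [indicator_of_mem hz, indicator_of_mem hpR]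
            simp only [d, n1, smul_eq_mul]
            rw [mul_comm]
            gcongr
            rw [ENNReal.ofReal_le_one]
            exact hpR.1.2.le
          · rw [indicator_of_notMem hz]; simp
      _ ≤ ∫⁻ p, R.indicator (fun p => ENNReal.ofReal ((η + 1) * (1 - p.1) ^ η) * 1) p :=
          setLIntegral_le_lintegral _ _
      _ = _ := by
          rw [lintegral_indicator mR]
          simp only [R]
          rw [Measure.volume_eq_prod, ← Measure.prod_restrict]
          rw [lintegral_prod_mul (f := fun x : ℝ => ENNReal.ofReal ((η + 1) * (1 - x) ^ η)) (g := fun _ : ℝ => 1)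
            (by fun_prop) (by fun_prop)]
          rw [radial_lintegral η hη h h0]
          congr 1
          simp
          congr 1; ring
  change _ * ∫⁻ z in S1, d z ≤ _
  rw [e4]
  refine (mul_le_mul_right e5 _).trans ?_
  rw [← ENNReal.ofReal_inv_of_pos Real.pi_pos, ← ENNReal.ofReal_mul (by positivity),
    ← ENNReal.ofReal_mul (by positivity)]
  apply ENNReal.ofReal_le_ofReal
  have : h ^ (η + 2) = h ^ (η + 1) * h := by
    rw [← Real.rpow_add_one h0.ne']; ring_nf
  rw [this]
  apply le_of_eq
  field_simp

lemma disc_eq {lam : ℂ} (hl : ‖lam‖ < 1) {r : ℝ} (hr1 : r < 1) :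
    discAt lam r = ball lam (r * (1 - ‖lam‖)) := by
  ext z
  simp only [discAt, mem_ofPred_eq, mem_ball, dist_eq_norm]
  refine ⟨fun h => h.2, fun h => ⟨?_, h⟩⟩
  have := norm_add_le (z - lam) lam
  rw [sub_add_cancel] at this
  nlinarith

lemma disc_measure (η : ℝ) (hη : -1 < η) (r : ℝ) (hr : 0 < r) (hr1 : r < 1) :
    ∃ c : ℝ, 0 < c ∧ ∀ lam : ℂ, ‖lam‖ < 1 →
      ENNReal.ofReal (c * (1 - ‖lam‖) ^ (η + 2)) ≤ measAeta η (discAt lam r) := by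
  refine ⟨(η + 1) * min ((1 - r) ^ η) ((1 + r) ^ η) * r ^ 2, ?_, fun lam hl => ?_⟩
  · have : 0 < η + 1 := by linarith
    have : 0 < 1 - r := by linarith
    have := lt_min (Real.rpow_pos_of_pos this η) (Real.rpow_pos_of_pos (by linarith : 0 < 1 + r) η)
    positivity
  have hb : discAt lam r ⊆ ball (0:ℂ) 1 := fun z hz => by simpa using hz.1
  set m := min ((1 - r) ^ η) ((1 + r) ^ η) with hm
  set δ := 1 - ‖lam‖ with hδ
  have hδ0 : 0 < δ := by simp only [hδ]; linarith
  have ms : MeasurableSet (discAt lam r) := by rw [disc_eq hl hr1]; exact measurableSet_ball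
  have hm0 : 0 ≤ m := le_min (Real.rpow_nonneg (by linarith) _) (Real.rpow_nonneg (by linarith) _)
  rw [measAeta_apply η ms hb]
  have key : ∀ z ∈ discAt lam r, ENNReal.ofReal ((η + 1) * (m * δ ^ η)) ≤
      ENNReal.ofReal ((η + 1) * (1 - ‖z‖) ^ η) := fun z hz => by
    apply ENNReal.ofReal_le_ofReal
    apply mul_le_mul_of_nonneg_left _ (by linarith)
    have h1 : (1 - r) * δ ≤ 1 - ‖z‖ := by
      have := norm_add_le (z - lam) lam
      rw [sub_add_cancel] at this
      have := hz.2
      simp only [hδ] at *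
      nlinarith
    have h2 : 1 - ‖z‖ ≤ (1 + r) * δ := by
      have := norm_sub_norm_le lam z
      rw [norm_sub_rev] at this
      have := hz.2
      simp only [hδ] at *
      nlinarith
    have h3 : 0 < (1 - r) * δ := mul_pos (by linarith) hδ0
    rcases le_total 0 η with h | h
    · calc m * δ ^ η ≤ (1 - r) ^ η * δ ^ η := by gcongr; exact min_le_left _ _
        _ = ((1 - r) * δ) ^ η := by rw [Real.mul_rpow (by linarith) hδ0.le]
        _ ≤ _ := Real.rpow_le_rpow h3.le h1 h
    · calc m * δ ^ η ≤ (1 + r) ^ η * δ ^ η := by gcongr; exact min_le_right _ _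
        _ = ((1 + r) * δ) ^ η := by rw [Real.mul_rpow (by linarith) hδ0.le]
        _ ≤ _ := Real.rpow_le_rpow_of_nonpos (h3.trans_le h1) h2 h
  calc _ = (ENNReal.ofReal Real.pi)⁻¹ * ∫⁻ z in discAt lam r, ENNReal.ofReal ((η + 1) * (m * δ ^ η)) := by
        rw [setLIntegral_const, disc_eq hl hr1, Complex.volume_ball]
        have hpi : (NNReal.pi : ℝ≥0∞) = ENNReal.ofReal Real.pi := by
          rw [ENNReal.ofReal, ← NNReal.coe_real_pi, Real.toNNReal_coe]
        rw [hpi, ← ENNReal.ofReal_inv_of_pos Real.pi_pos, ← ENNReal.ofReal_pow (by positivity),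
          ← ENNReal.ofReal_mul (by positivity), ← ENNReal.ofReal_mul, ← ENNReal.ofReal_mul (by positivity)]
        · congr 1
          have : δ ^ (η + 2) = δ ^ η * δ ^ 2 := by
            rw [Real.rpow_add hδ0]; norm_num
          rw [this]
          field_simp
          rw [hδ]
        · have : 0 ≤ η + 1 := by linarith
          positivity
    _ ≤ _ := by
        gcongr 1
        exact setLIntegral_mono' ms key
lemma B2_pos {η : ℝ} {W Winv : ℂ → H →L[ℂ] H} (hW : IsB2Weight η W Winv) :
    ∀ᵐ z ∂(measAeta η), (W z).IsPositive ∧ W z ∘L Winv z = 1 :=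
  Filter.Eventually.mono ((measAeta_ac η).ae_le hW.1) fun _ hz => ⟨hz.1, hz.2.1⟩

lemma B2_int {η : ℝ} {W Winv : ℂ → H →L[ℂ] H} (hW : IsB2Weight η W Winv) (e : H) :
    Integrable (fun z => (W z).reApplyInnerSelf e) (measAeta η) := by
  obtain ⟨TW, h1, -⟩ := hW.2.1
  have := (re_eq_of_weak h1 e).1
  rwa [measAeta_restrict] at this

lemma B2_nonneg {η : ℝ} {W Winv : ℂ → H →L[ℂ] H} (hW : IsB2Weight η W Winv) (e : H) :
    0 ≤ᵐ[measAeta η] (fun z => (W z).reApplyInnerSelf e) :=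
  (B2_pos hW).mono fun _ hz => hz.1.re_inner_nonneg_left e

lemma B2_key {η : ℝ} (hη : -1 < η) {W Winv : ℂ → H →L[ℂ] H} (hW : IsB2Weight η W Winv) :
    ∃ c : ℝ, 0 < c ∧ ∀ h θ : ℝ, 0 < h → h < 1 → 0 ≤ θ → θ < 2 * Real.pi →
      ∀ E : Set ℂ, E ⊆ carlesonSquare h θ → ∀ e : H,
      ((measAeta η) E).toReal ^ 2 * ∫ z in carlesonSquare h θ, (W z).reApplyInnerSelf e ∂(measAeta η)
      ≤ c * ((measAeta η) (carlesonSquare h θ)).toReal ^ 2 *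
        ∫ z in E, (W z).reApplyInnerSelf e ∂(measAeta η) := by
  have hpos := B2_pos hW
  have hWint := B2_int hW
  have hnn := B2_nonneg hW
  obtain ⟨-, ⟨TW, hTW, -⟩, ⟨TWi, hTWi⟩, c0, hc0⟩ := hW
  set ν := measAeta η with hν
  have hipos : ∀ᵐ z ∂ν, (Winv z).IsPositive := hpos.mono fun z hz => inv_positive hz.1 hz.2
  have hiint : ∀ x, Integrable (fun z => (Winv z).reApplyInnerSelf x) ν := fun x => by
    have := (re_eq_of_weak hTWi x).1
    rwa [measAeta_restrict] at this
  refine ⟨(max c0 1) ^ 2, by positivity, fun h θ h0 h1 t0 t1 E hE e => ?_⟩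
  set S := carlesonSquare h θ with hS
  have hSfin : ν S ≠ ∞ := ((square_measure η hη h h0 h1 θ).trans_lt ENNReal.ofReal_lt_top).ne
  have hEfin : ν E ≠ ∞ := ((measure_mono hE).trans_lt (lt_top_iff_ne_top.2 hSfin)).ne
  have hwE : 0 ≤ ∫ z in E, (W z).reApplyInnerSelf e ∂ν :=
    integral_nonneg_of_ae (ae_restrict_of_ae (hnn e))
  rcases eq_or_lt_of_le (ENNReal.toReal_nonneg : 0 ≤ (ν E).toReal) with hE0 | hE0
  · rw [← hE0]
    have : 0 ≤ (max c0 1) ^ 2 * (ν S).toReal ^ 2 := by positivity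
    simpa using mul_nonneg this hwE
  have hES : (ν E).toReal ≤ (ν S).toReal := ENNReal.toReal_mono hSfin (measure_mono hE)
  have hS0 := hE0.trans_le hES
  set s := (ν S).toReal with hs
  set m := (ν E).toReal with hm
  obtain ⟨P, hP, hPp⟩ := exists_weak (hpos.mono fun z hz => hz.1) (measAeta_restrict η) hTW S
  obtain ⟨Q, hQ, hQp⟩ := exists_weak hipos (measAeta_restrict η) hTWi S
  have hsm : ∀ A : H →L[ℂ] H, A.IsPositive → (s⁻¹ • A).IsPositive := fun A hA => by
    rw [← ContinuousLinearMap.nonneg_iff_isPositive] at hA ⊢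
    exact smul_nonneg (by positivity) hA
  have hsre : ∀ (A : H →L[ℂ] H) x, (s⁻¹ • A).reApplyInnerSelf x = s⁻¹ * A.reApplyInnerSelf x := by
    intro A x
    rw [ContinuousLinearMap.reApplyInnerSelf_apply, ContinuousLinearMap.reApplyInnerSelf_apply]
    have : (s⁻¹ • A) x = ((s⁻¹ : ℝ) : ℂ) • A x := rfl
    rw [this, inner_smul_left]
    simp
  obtain ⟨Ps, hPs, hPs2⟩ := pos_sqrt (hsm P hPp)
  obtain ⟨Qs, hQs, hQs2⟩ := pos_sqrt (hsm Q hQp)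
  have hn := hc0 h θ h0 h1 t0 t1 P Q Ps Qs hP hQ hPs hQs hPs2 hQs2
  set c := max c0 1 with hc
  have hc1 : 0 < c := lt_of_lt_of_le one_pos (le_max_right _ _)
  -- the adjoint
  have hadj : ∀ y, ‖Qs (Ps y)‖ ≤ c * ‖y‖ := by
    intro y
    have h2 : ContinuousLinearMap.adjoint (Ps ∘L Qs) = Qs ∘L Ps := by
      rw [ContinuousLinearMap.adjoint_comp, hPs.isSelfAdjoint.adjoint_eq,
        hQs.isSelfAdjoint.adjoint_eq]
    have h3 : ‖Qs ∘L Ps‖ ≤ c := by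
      rw [← h2, LinearIsometryEquiv.norm_map]
      exact hn.trans (le_max_left _ _)
    exact (ContinuousLinearMap.le_opNorm (Qs ∘L Ps) y).trans (by gcongr)
  set x := (s⁻¹ • P) e with hx
  set p := ‖Ps e‖ ^ 2 with hp
  have hp0 : 0 ≤ p := by positivity
  have hex : ‖⟪e, x⟫_ℂ‖ = p := by
    rw [hx, ← hPs2, ← inner_conj_symm, RCLike.norm_conj, sqrt_inner hPs, inner_self_eq_norm_sq_to_K]
    simp [hp]
  have hQx : Q.reApplyInnerSelf x ≤ s * (c ^ 2 * p) := by
    have h2 : s⁻¹ * Q.reApplyInnerSelf x = ‖Qs x‖ ^ 2 := by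
      rw [← hsre, ← hQs2, sqrt_re hQs]
    have h3 : ‖Qs x‖ ≤ c * ‖Ps e‖ := by
      rw [hx, ← hPs2]
      exact hadj (Ps e)
    have h4 : s⁻¹ * Q.reApplyInnerSelf x ≤ c ^ 2 * p := by
      rw [h2, hp, ← mul_pow]; gcongr
    rwa [inv_mul_le_iff₀ hS0] at h4
  have hwS : ∫ z in S, (W z).reApplyInnerSelf e ∂ν = s * p := by
    rw [← (re_eq_of_weak hP e).2]
    have : s⁻¹ * P.reApplyInnerSelf e = p := by rw [← hsre, ← hPs2, sqrt_re hPs]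
    rw [← this]; field_simp
  have hvE : ∫ z in E, (Winv z).reApplyInnerSelf x ∂ν ≤ s * (c ^ 2 * p) := by
    refine le_trans ?_ hQx
    rw [(re_eq_of_weak hQ x).2]
    exact setIntegral_mono_set (hiint x).integrableOn
      (ae_restrict_of_ae (hipos.mono fun z hz => hz.re_inner_nonneg_left x))
      (LE.le.eventuallyLE hE)
  set t := s * c ^ 2 / m with ht
  have ht0 : 0 < t := by positivity
  have main : m * (2 * p) ≤ t * ∫ z in E, (W z).reApplyInnerSelf e ∂ν +
      t⁻¹ * ∫ z in E, (Winv z).reApplyInnerSelf x ∂ν := by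
    have hfin : IsFiniteMeasure (ν.restrict E) := ⟨by simpa using lt_top_iff_ne_top.2 hEfin⟩
    have := integral_mono_ae (μ := ν.restrict E) (f := fun _ => 2 * p)
      (g := fun z => t * (W z).reApplyInnerSelf e + t⁻¹ * (Winv z).reApplyInnerSelf x)
      (integrable_const _)
      (((hWint e).restrict.const_mul t).add ((hiint x).restrict.const_mul t⁻¹))
      (by
        filter_upwards [ae_restrict_of_ae hpos] with z hz
        have := pair_amgm hz.1 hz.2 e x ht0
        rwa [hex] at this)
    rw [integral_const, integral_add ((hWint e).restrict.const_mul t) ((hiint x).restrict.const_mul t⁻¹),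
      integral_const_mul, integral_const_mul, smul_eq_mul] at this
    simpa [Measure.real] using this
  have h5 : t⁻¹ * ∫ z in E, (Winv z).reApplyInnerSelf x ∂ν ≤ m * p := by
    refine (mul_le_mul_of_nonneg_left hvE (inv_pos.2 ht0).le).trans (le_of_eq ?_)
    rw [ht]; field_simp
  have h6 : m * p ≤ t * ∫ z in E, (W z).reApplyInnerSelf e ∂ν := by linarith
  rw [hwS]
  calc m ^ 2 * (s * p) = (m * s) * (m * p) := by ring
    _ ≤ (m * s) * (t * ∫ z in E, (W z).reApplyInnerSelf e ∂ν) := by gcongr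
    _ = _ := by rw [ht]; field_simp
/-- The scalar weighted measure `⟨W e, e⟩ dA_η`. -/
def wMeas (η : ℝ) (W : ℂ → H →L[ℂ] H) (e : H) : Measure ℂ :=
  (measAeta η).withDensity fun z => ENNReal.ofReal ((W z).reApplyInnerSelf e)

lemma wMeas_apply {η : ℝ} {W Winv : ℂ → H →L[ℂ] H} (hW : IsB2Weight η W Winv) (e : H) (S : Set ℂ) :
    wMeas η W e S = ENNReal.ofReal (∫ z in S, (W z).reApplyInnerSelf e ∂(measAeta η)) := by
  unfold wMeas
  rw [withDensity_apply', ofReal_integral_eq_lintegral_ofReal (B2_int hW e).restrict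
    (ae_restrict_of_ae (B2_nonneg hW e))]

lemma wMeas_ac {η : ℝ} {W : ℂ → H →L[ℂ] H} (e : H) : wMeas η W e ≪ measAeta η :=
  withDensity_absolutelyContinuous _ _

lemma B2_enn {η : ℝ} (hη : -1 < η) {W Winv : ℂ → H →L[ℂ] H} (hW : IsB2Weight η W Winv) :
    ∃ c : ℝ, 0 < c ∧ ∀ h θ : ℝ, 0 < h → h < 1 → 0 ≤ θ → θ < 2 * Real.pi →
      ∀ E : Set ℂ, E ⊆ carlesonSquare h θ → ∀ e : H,
      ((measAeta η) E) ^ 2 * wMeas η W e (carlesonSquare h θ)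
      ≤ ENNReal.ofReal (4 * c * (h ^ (η + 2)) ^ 2) * wMeas η W e E := by
  obtain ⟨c, hc, H1⟩ := B2_key hη hW
  refine ⟨c, hc, fun h θ h0 h1 t0 t1 E hE e => ?_⟩
  have h2 := H1 h θ h0 h1 t0 t1 E hE e
  have hSm := square_measure η hη h h0 h1 θ
  have hSfin : measAeta η (carlesonSquare h θ) ≠ ∞ := (hSm.trans_lt ENNReal.ofReal_lt_top).ne
  have hEfin : measAeta η E ≠ ∞ :=
    ((measure_mono hE).trans_lt (lt_top_iff_ne_top.2 hSfin)).ne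
  have hwE : 0 ≤ ∫ z in E, (W z).reApplyInnerSelf e ∂(measAeta η) :=
    integral_nonneg_of_ae (ae_restrict_of_ae (B2_nonneg hW e))
  have hs : (measAeta η (carlesonSquare h θ)).toReal ≤ 2 * h ^ (η + 2) := by
    apply ENNReal.toReal_le_of_le_ofReal (by positivity) hSm
  rw [wMeas_apply hW, wMeas_apply hW, ← ENNReal.ofReal_toReal hEfin,
    ← ENNReal.ofReal_pow ENNReal.toReal_nonneg, ← ENNReal.ofReal_mul (by positivity),
    ← ENNReal.ofReal_mul (by positivity)]
  apply ENNReal.ofReal_le_ofReal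
  refine h2.trans ?_
  have : c * (measAeta η (carlesonSquare h θ)).toReal ^ 2 ≤ c * (2 * h ^ (η + 2)) ^ 2 := by gcongr
  calc _ ≤ c * (2 * h ^ (η + 2)) ^ 2 * ∫ z in E, (W z).reApplyInnerSelf e ∂(measAeta η) := by gcongr
    _ = _ := by ring

lemma square_mono {h h' θ : ℝ} (hh : h ≤ h') : carlesonSquare h θ ⊆ carlesonSquare h' θ := by
  rintro z ⟨ρ, t, h1, h2, h3, h4⟩
  exact ⟨ρ, t, by linarith, h2, h3.trans_le (by gcongr), h4⟩

lemma null_im : volume {z : ℂ | z.im = 0} = 0 := by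
  have := Measure.addHaar_submodule (volume : Measure ℂ) (LinearMap.ker imLm) (by
    intro h
    have : I ∈ LinearMap.ker imLm := by rw [h]; trivial
    simp at this)
  convert this using 2
  ext z
  simp

lemma B2_full {η : ℝ} (hη : -1 < η) {W : ℂ → H →L[ℂ] H} {c : ℝ}
    (H1 : ∀ h θ : ℝ, 0 < h → h < 1 → 0 ≤ θ → θ < 2 * Real.pi →
      ∀ E : Set ℂ, E ⊆ carlesonSquare h θ → ∀ e : H,
      ((measAeta η) E) ^ 2 * wMeas η W e (carlesonSquare h θ)
      ≤ ENNReal.ofReal (4 * c * (h ^ (η + 2)) ^ 2) * wMeas η W e E) (hc : 0 < c) (D : Set ℂ) (e : H)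
      (hfin : wMeas η W e univ ≠ ∞) :
      ((measAeta η) D) ^ 2 * wMeas η W e univ ≤ ENNReal.ofReal (4 * c) * wMeas η W e D := by
  let h : ℕ → ℝ := fun j => 1 - 1 / ((j : ℝ) + 2)
  have h0 : ∀ j, 0 < h j := fun j => by
    have : 1 / ((j : ℝ) + 2) < 1 := by rw [div_lt_one (by positivity)]; linarith [(Nat.cast_nonneg j : (0:ℝ) ≤ j)]
    simp only [h]; linarith
  have h1 : ∀ j, h j < 1 := fun j => by
    have : 0 < 1 / ((j : ℝ) + 2) := by positivity
    simp only [h]; linarith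
  have hm : Monotone h := fun i j hij => by
    simp only [h]
    gcongr
  have hl : Filter.Tendsto h Filter.atTop (nhds 1) := by
    have a1 : Filter.Tendsto (fun j : ℕ => 1 / ((j : ℝ) + 2)) Filter.atTop (nhds 0) := by
      have := (tendsto_one_div_add_atTop_nhds_zero_nat (𝕜 := ℝ)).comp (Filter.tendsto_add_atTop_nat 1)
      refine this.congr fun j => ?_
      simp only [Function.comp]
      push_cast; ring_nf
    simpa [h] using a1.const_sub 1
  let S : ℕ → Set ℂ := fun j => carlesonSquare (h j) 0
  have Sm : Monotone S := fun i j hij => square_mono (hm hij)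
  have hU : ∀ᵐ z ∂(measAeta η), z ∈ ⋃ j, S j := by
    have hn : ∀ᵐ z ∂(measAeta η), z.im ≠ 0 := by
      have : ∀ᵐ z : ℂ, z.im ≠ 0 := by
        rw [ae_iff]; simpa using null_im
      exact ((measAeta_ac η).trans areaM_ac).ae_le this
    filter_upwards [hn, measAeta_ball η] with z hz hzb
    have hz0 : z ≠ 0 := fun h => hz (by simp [h])
    have hzn : 0 < ‖z‖ := norm_pos_iff.2 hz0
    have hzb' : ‖z‖ < 1 := by simpa using hzb
    have harg : |arg z| < Real.pi := by
      rw [abs_lt]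
      refine ⟨neg_pi_lt_arg z, lt_of_le_of_ne (arg_le_pi z) fun h => ?_⟩
      rw [arg_eq_pi_iff] at h
      exact hz h.2
    have ev1 : ∀ᶠ j in Filter.atTop, 1 - ‖z‖ < h j := hl.eventually_const_lt (by linarith)
    have ev2 : ∀ᶠ j in Filter.atTop, |arg z| < Real.pi * h j := by
      have := hl.const_mul Real.pi
      rw [mul_one] at this
      exact this.eventually_const_lt harg
    obtain ⟨j, hj1, hj2⟩ := (ev1.and ev2).exists
    refine mem_iUnion.2 ⟨j, ‖z‖, arg z, by linarith, hzb', by simpa using hj2, ?_⟩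
    exact (norm_mul_exp_arg_mul_I z).symm
  have t1 : Filter.Tendsto (fun j => wMeas η W e (S j)) Filter.atTop (nhds (wMeas η W e univ)) := by
    have : wMeas η W e univ = wMeas η W e (⋃ j, S j) := by
      apply measure_congr
      filter_upwards [(wMeas_ac e).ae_le hU] with z hz
      apply propext
      exact ⟨fun _ => hz, fun _ => trivial⟩
    rw [this]
    exact tendsto_measure_iUnion_atTop Sm
  have t2 : Filter.Tendsto (fun j => measAeta η (D ∩ S j)) Filter.atTop (nhds (measAeta η D)) := by
    have : measAeta η D = measAeta η (⋃ j, D ∩ S j) := by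
      rw [← inter_iUnion]
      apply measure_congr
      filter_upwards [hU] with z hz
      apply propext
      exact ⟨fun h => ⟨h, hz⟩, fun h => h.1⟩
    rw [this]
    exact tendsto_measure_iUnion_atTop fun i j hij => inter_subset_inter_right D (Sm hij)
  by_cases h00 : wMeas η W e univ = 0
  · rw [h00]; simp
  have hDfin : measAeta η D ≠ ∞ := by
    have : measAeta η D ≤ 2 := by
      refine le_of_tendsto' t2 fun j => ?_
      refine (measure_mono inter_subset_right).trans ((square_measure η hη _ (h0 j) (h1 j) 0).trans ?_)
      rw [← ENNReal.ofReal_ofNat]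
      apply ENNReal.ofReal_le_ofReal
      have : h j ^ (η + 2) ≤ 1 := Real.rpow_le_one (h0 j).le (h1 j).le (by linarith)
      linarith
    exact (this.trans_lt (by simp)).ne
  have t3 := ENNReal.Tendsto.mul (ENNReal.Tendsto.pow (n := 2) t2) (Or.inr hfin) t1
    (Or.inr (ENNReal.pow_ne_top hDfin))
  refine le_of_tendsto' t3 fun j => ?_
  refine (H1 (h j) 0 (h0 j) (h1 j) le_rfl (by positivity) _ inter_subset_right e).trans ?_
  have : h j ^ (η + 2) ≤ 1 := Real.rpow_le_one (h0 j).le (h1 j).le (by linarith)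
  have h3 : (h j ^ (η + 2)) ^ 2 ≤ 1 := pow_le_one₀ (Real.rpow_nonneg (h0 j).le _) this
  refine mul_le_mul' (ENNReal.ofReal_le_ofReal ?_) (measure_mono inter_subset_left)
  nlinarith

/-- Nonisotropic ball. -/
def kBall (lam : ℂ) (τ : ℝ) : Set ℂ := {z | ‖z‖ < 1 ∧ ‖1 - (starRingEnd ℂ) lam * z‖ < τ}

lemma kBall_sub {lam : ℂ} (hl : ‖lam‖ < 1) {τ : ℝ} (h1 : τ < 1) :
    ∃ θ : ℝ, 0 ≤ θ ∧ θ < 2 * Real.pi ∧ kBall lam τ ⊆ carlesonSquare τ θ := by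
  obtain ⟨θ, t0, t1, hθ⟩ : ∃ θ : ℝ, 0 ≤ θ ∧ θ < 2 * Real.pi ∧
      lam = ‖lam‖ * Complex.exp (θ * I) := by
    rcases le_or_gt 0 (arg lam) with h | h
    · exact ⟨arg lam, h, by linarith [arg_le_pi lam, Real.pi_pos], (norm_mul_exp_arg_mul_I lam).symm⟩
    · refine ⟨arg lam + 2 * Real.pi, by linarith [neg_pi_lt_arg lam, Real.pi_pos], by linarith, ?_⟩
      push_cast
      rw [add_mul, Complex.exp_add, Complex.exp_two_pi_mul_I, mul_one]
      exact (norm_mul_exp_arg_mul_I lam).symm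
  refine ⟨θ, t0, t1, ?_⟩
  rintro z ⟨hz, hw⟩
  set w := (starRingEnd ℂ) lam * z with hwd
  have hw0 : w ≠ 0 := fun h => by rw [h] at hw; simp at hw; linarith
  have hl0 : lam ≠ 0 := fun h => hw0 (by simp [hwd, h])
  have hz0 : z ≠ 0 := fun h => hw0 (by simp [hwd, h])
  have hln := norm_pos_iff.2 hl0
  have hzn := norm_pos_iff.2 hz0
  have hwn : ‖w‖ = ‖lam‖ * ‖z‖ := by rw [hwd, norm_mul, RCLike.norm_conj]
  refine ⟨‖z‖, θ + arg w, ?_, hz, ?_, ?_⟩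
  · have := norm_sub_norm_le 1 w
    rw [norm_one, hwn] at this
    nlinarith
  · have hre : 0 < w.re := by
      have := abs_re_le_norm (1 - w)
      simp only [sub_re, one_re] at this
      have := (abs_lt.1 (this.trans_lt (hw.trans h1))).2
      linarith
    have ha : |arg w| ≤ Real.pi / 2 := abs_arg_le_pi_div_two_iff.2 hre.le
    have hs := Real.mul_le_sin (abs_nonneg (arg w)) ha
    have hs2 : Real.sin |arg w| = |Real.sin (arg w)| := by
      rcases le_total 0 (arg w) with h | h
      · rw [abs_of_nonneg h, abs_of_nonneg]
        exact Real.sin_nonneg_of_nonneg_of_le_pi h (arg_le_pi w)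
      · rw [abs_of_nonpos h, Real.sin_neg, abs_of_nonpos]
        exact Real.sin_nonpos_of_nonpos_of_neg_pi_le h (neg_pi_lt_arg w).le
    have hs3 : |Real.sin (arg w)| ≤ ‖1 - w‖ := by
      rw [Complex.sin_arg, abs_div, abs_norm, div_le_iff₀ (norm_pos_iff.2 hw0)]
      have e1 : w.im = (w * (starRingEnd ℂ) (1 - w)).im := by
        simp; ring
      rw [e1]
      refine (abs_im_le_norm _).trans ?_
      rw [norm_mul, RCLike.norm_conj, mul_comm]
    rw [add_sub_cancel_left]
    have hh : 2 / Real.pi * |arg w| < τ := (hs.trans (hs2.le.trans hs3)).trans_lt hw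
    rw [div_mul_eq_mul_div, div_lt_iff₀ Real.pi_pos] at hh
    nlinarith [abs_nonneg (arg w)]
  · have e1 : (‖w‖ : ℂ) * Complex.exp (arg w * I) = (starRingEnd ℂ) lam * z := norm_mul_exp_arg_mul_I w
    have e2 : lam * (starRingEnd ℂ) lam = (‖lam‖ : ℂ) ^ 2 := by
      rw [mul_conj, normSq_eq_norm_sq]; push_cast; rfl
    have e3 : (‖lam‖ : ℂ) ≠ 0 := by exact_mod_cast hln.ne'
    push_cast
    rw [add_mul, Complex.exp_add]
    have e4 : (‖lam‖ : ℂ) ^ 2 * z = (‖lam‖ : ℂ) ^ 2 * (‖z‖ * (Complex.exp (θ * I) * Complex.exp (arg w * I))) := by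
      calc (‖lam‖ : ℂ) ^ 2 * z = lam * ((starRingEnd ℂ) lam * z) := by rw [← e2]; ring
        _ = (‖lam‖ * Complex.exp (θ * I)) * ((‖w‖ : ℂ) * Complex.exp (arg w * I)) := by
            rw [e1, ← hθ]
        _ = _ := by rw [hwn]; push_cast; ring
    exact mul_left_cancel₀ (pow_ne_zero 2 e3) e4

lemma disc_bound {lam z : ℂ} (hl : ‖lam‖ < 1) {r : ℝ} (hr1 : r < 1)
    (hz : z ∈ discAt lam r) : ‖1 - (starRingEnd ℂ) lam * z‖ < 3 * (1 - ‖lam‖) := by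
  have e : 1 - (starRingEnd ℂ) lam * z = ((1 - ‖lam‖ ^ 2 : ℝ) : ℂ) + (starRingEnd ℂ) lam * (lam - z) := by
    have e2 : lam * (starRingEnd ℂ) lam = (‖lam‖ : ℂ) ^ 2 := by
      rw [mul_conj, normSq_eq_norm_sq]; push_cast; rfl
    push_cast
    rw [← e2]; ring
  have h2 := hz.2
  rw [e]
  refine (norm_add_le _ _).trans_lt ?_
  rw [norm_mul, RCLike.norm_conj, Complex.norm_real, norm_sub_rev lam z,
    Real.norm_of_nonneg (by nlinarith [norm_nonneg lam])]
  have h3 : ‖lam‖ * ‖z - lam‖ ≤ 1 * ‖z - lam‖ := by gcongr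
  nlinarith [norm_nonneg lam]

lemma B2_doubling {η : ℝ} (hη : -1 < η) {r : ℝ} (hr : 0 < r) (hr1 : r < 1)
    {W Winv : ℂ → H →L[ℂ] H} (hW : IsB2Weight η W Winv) :
    ∃ C : ℝ, 0 < C ∧ ∃ N : ℕ, ∀ lam : ℂ, ‖lam‖ < 1 → ∀ τ : ℝ, 3 * (1 - ‖lam‖) ≤ τ → ∀ e : H,
      wMeas η W e (kBall lam τ) ≤
        ENNReal.ofReal (C * ((τ / (1 - ‖lam‖)) ^ N) ^ 2) * wMeas η W e (discAt lam r) := by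
  obtain ⟨c, hc, H1⟩ := B2_enn hη hW
  obtain ⟨d, hd, H2⟩ := disc_measure η hη r hr hr1
  obtain ⟨N, hN⟩ := exists_nat_ge (η + 2)
  refine ⟨4 * c / d ^ 2, by positivity, N, fun lam hl τ hτ e => ?_⟩
  set δ := 1 - ‖lam‖ with hδ
  have hδ0 : 0 < δ := by simp only [hδ]; linarith
  have hτ0 : 0 < τ := by linarith
  have main : (measAeta η (discAt lam r)) ^ 2 * wMeas η W e (kBall lam τ) ≤
      ENNReal.ofReal (4 * c * (τ ^ (η + 2)) ^ 2) * wMeas η W e (discAt lam r) := by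
    rcases lt_or_ge τ 1 with h1 | h1
    · obtain ⟨θ, t0, t1, hs⟩ := kBall_sub hl h1
      have hD : discAt lam r ⊆ kBall lam τ := fun z hz =>
        ⟨hz.1, (disc_bound hl hr1 hz).trans_le hτ⟩
      refine le_trans ?_ (H1 τ θ hτ0 h1 t0 t1 _ (hD.trans hs) e)
      gcongr
    · have hfin : wMeas η W e univ ≠ ∞ := by rw [wMeas_apply hW]; exact ENNReal.ofReal_ne_top
      refine le_trans ?_ ((B2_full hη H1 hc (discAt lam r) e hfin).trans ?_)
      · gcongr; exact subset_univ _
      · refine mul_le_mul' (ENNReal.ofReal_le_ofReal ?_) le_rfl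
        have : 1 ≤ τ ^ (η + 2) := Real.one_le_rpow h1 (by linarith)
        have : 1 ≤ (τ ^ (η + 2)) ^ 2 := one_le_pow₀ this
        nlinarith
  have h2 := H2 lam hl
  set a := d * δ ^ (η + 2) with ha
  have ha0 : 0 < a := by positivity
  have h3 : ENNReal.ofReal (a ^ 2) * wMeas η W e (kBall lam τ) ≤
      ENNReal.ofReal (4 * c * (τ ^ (η + 2)) ^ 2) * wMeas η W e (discAt lam r) := by
    refine le_trans ?_ main
    rw [ENNReal.ofReal_pow ha0.le]
    gcongr
  have h4 : ENNReal.ofReal ((a ^ 2)⁻¹) * ENNReal.ofReal (a ^ 2) = 1 := by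
    rw [← ENNReal.ofReal_mul (by positivity), inv_mul_cancel₀ (by positivity), ENNReal.ofReal_one]
  calc wMeas η W e (kBall lam τ)
      = ENNReal.ofReal ((a ^ 2)⁻¹) * (ENNReal.ofReal (a ^ 2) * wMeas η W e (kBall lam τ)) := by
        rw [← mul_assoc, h4, one_mul]
    _ ≤ ENNReal.ofReal ((a ^ 2)⁻¹) *
        (ENNReal.ofReal (4 * c * (τ ^ (η + 2)) ^ 2) * wMeas η W e (discAt lam r)) := by gcongr
    _ = ENNReal.ofReal ((a ^ 2)⁻¹ * (4 * c * (τ ^ (η + 2)) ^ 2)) * wMeas η W e (discAt lam r) := by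
        rw [← mul_assoc, ← ENNReal.ofReal_mul (by positivity)]
    _ ≤ _ := by
        refine mul_le_mul' (ENNReal.ofReal_le_ofReal ?_) le_rfl
        have e1 : (a ^ 2)⁻¹ * (4 * c * (τ ^ (η + 2)) ^ 2) = 4 * c / d ^ 2 * ((τ / δ) ^ (η + 2)) ^ 2 := by
          rw [Real.div_rpow hτ0.le hδ0.le, ha]
          field_simp
        rw [e1]
        have h5 : 1 ≤ τ / δ := by rw [one_le_div hδ0]; linarith
        have : (τ / δ) ^ (η + 2) ≤ (τ / δ) ^ N := by
          rw [← Real.rpow_natCast]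
          exact Real.rpow_le_rpow_of_exponent_le h5 hN
        gcongr
lemma one_sub_ge {lam z : ℂ} (hz : ‖z‖ < 1) : 1 - ‖lam‖ ≤ ‖1 - (starRingEnd ℂ) lam * z‖ := by
  have := norm_sub_norm_le 1 ((starRingEnd ℂ) lam * z)
  rw [norm_one, norm_mul, RCLike.norm_conj] at this
  nlinarith [norm_nonneg lam]

lemma wMeas_ball {η : ℝ} {W : ℂ → H →L[ℂ] H} (e : H) : ∀ᵐ z ∂(wMeas η W e), ‖z‖ < 1 := by
  filter_upwards [(wMeas_ac e).ae_le (measAeta_ball η)] with z hz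
  simpa using hz

lemma kBall_meas (lam : ℂ) (τ : ℝ) : MeasurableSet (kBall lam τ) := by
  refine MeasurableSet.inter ?_ ?_
  · exact measurableSet_lt measurable_norm measurable_const
  · exact measurableSet_lt (f := fun z : ℂ => ‖1 - (starRingEnd ℂ) lam * z‖) (by fun_prop) measurable_const

lemma kernel_int {η : ℝ} {r : ℝ} {W : ℂ → H →L[ℂ] H} {C : ℝ} (hC : 0 < C) {N : ℕ}
    (H1 : ∀ lam : ℂ, ‖lam‖ < 1 → ∀ τ : ℝ, 3 * (1 - ‖lam‖) ≤ τ → ∀ e : H,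
      wMeas η W e (kBall lam τ) ≤
        ENNReal.ofReal (C * ((τ / (1 - ‖lam‖)) ^ N) ^ 2) * wMeas η W e (discAt lam r))
    (lam : ℂ) (hl : ‖lam‖ < 1) (e : H) :
    ∫⁻ z, ENNReal.ofReal ((‖1 - (starRingEnd ℂ) lam * z‖ ^ (N + 1))⁻¹ ^ 2) ∂(wMeas η W e) ≤
      ENNReal.ofReal (C * 16 ^ N * 2 * ((1 - ‖lam‖) ^ (N + 1))⁻¹ ^ 2) * wMeas η W e (discAt lam r) := by
  set δ := 1 - ‖lam‖ with hδ
  have hδ0 : 0 < δ := by simp only [hδ]; linarith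
  let A : ℕ → ℝ := fun k => ((2 ^ k * δ) ^ (N + 1))⁻¹ ^ 2
  let F : ℕ → ℂ → ℝ≥0∞ := fun k => (kBall lam (2 ^ (k + 2) * δ)).indicator fun _ => ENNReal.ofReal (A k)
  have hpt : ∀ᵐ z ∂(wMeas η W e), ENNReal.ofReal ((‖1 - (starRingEnd ℂ) lam * z‖ ^ (N + 1))⁻¹ ^ 2)
      ≤ ∑' k, F k z := by
    filter_upwards [wMeas_ball e] with z hz
    have hge := one_sub_ge (lam := lam) hz
    set x := ‖1 - (starRingEnd ℂ) lam * z‖ with hx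
    obtain ⟨k, hk1, hk2⟩ := exists_nat_pow_near (x := x / δ) (y := 2) (by rwa [one_le_div hδ0]) (by norm_num)
    rw [le_div_iff₀ hδ0] at hk1
    rw [div_lt_iff₀ hδ0] at hk2
    have hmem : z ∈ kBall lam (2 ^ (k + 2) * δ) := by
      refine ⟨hz, hk2.trans ?_⟩
      gcongr <;> norm_num
    refine le_trans ?_ (ENNReal.le_tsum k)
    simp only [F]
    rw [indicator_of_mem hmem]
    apply ENNReal.ofReal_le_ofReal
    simp only [A]
    gcongr
  have hterm : ∀ k, ∫⁻ z, F k z ∂(wMeas η W e) ≤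
      ENNReal.ofReal (C * 16 ^ N * (δ ^ (N + 1))⁻¹ ^ 2 * (1 / 2) ^ k) * wMeas η W e (discAt lam r) := by
    intro k
    simp only [F]
    rw [lintegral_indicator_const (kBall_meas _ _)]
    have h2 : (2:ℝ) ^ (k + 2) = 4 * 2 ^ k := by ring
    have h1 : (1:ℝ) ≤ 2 ^ k := one_le_pow₀ (by norm_num)
    have := H1 lam hl (2 ^ (k + 2) * δ) (by nlinarith) e
    refine (mul_le_mul' le_rfl this).trans ?_
    rw [← mul_assoc, ← ENNReal.ofReal_mul (by positivity)]
    refine mul_le_mul' (ENNReal.ofReal_le_ofReal ?_) le_rfl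
    rw [mul_div_assoc, div_self hδ0.ne', mul_one, h2]
    simp only [A]
    have e1 : (1 / 2 : ℝ) ^ k = (2 ^ k)⁻¹ := by rw [one_div, inv_pow]
    rw [e1]
    set u : ℝ := 2 ^ k with hu
    have hu0 : 0 < u := by positivity
    have e2 : ((u * δ) ^ (N + 1))⁻¹ ^ 2 * (C * ((4 * u) ^ N) ^ 2)
        = C * 16 ^ N * (δ ^ (N + 1))⁻¹ ^ 2 * (u⁻¹) ^ 2 := by
      have : (16:ℝ) ^ N = (4 ^ N) ^ 2 := by rw [← pow_mul, mul_comm, pow_mul]; norm_num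
      rw [this, mul_pow, mul_pow, pow_succ u]
      field_simp
    rw [e2]
    have : u⁻¹ ^ 2 ≤ u⁻¹ := by
      have h3 : u⁻¹ ≤ 1 := inv_le_one_of_one_le₀ h1
      have h4 : 0 < u⁻¹ := by positivity
      nlinarith
    gcongr
  calc _ ≤ ∫⁻ z, ∑' k, F k z ∂(wMeas η W e) := lintegral_mono_ae hpt
    _ = ∑' k, ∫⁻ z, F k z ∂(wMeas η W e) := by
        refine lintegral_tsum fun k => ?_
        exact (measurable_const.indicator (kBall_meas _ _)).aemeasurable
    _ ≤ ∑' k : ℕ, ENNReal.ofReal (C * 16 ^ N * (δ ^ (N + 1))⁻¹ ^ 2 * (1 / 2) ^ k) *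
          wMeas η W e (discAt lam r) := ENNReal.tsum_le_tsum hterm
    _ = _ := by
        rw [ENNReal.tsum_mul_right, ← ENNReal.ofReal_tsum_of_nonneg (fun k => by positivity)
          (summable_geometric_two.mul_left _), tsum_mul_left, tsum_geometric_two]
        congr 2
        ring

lemma kernel_deriv (lam : ℂ) (hl : ‖lam‖ < 1) (m : ℕ) (hm : 0 < m) (e : H) (n : ℕ) :
    ∃ a : ℕ, 1 ≤ a ∧ ∀ z : ℂ, ‖z‖ < 1 →
      iteratedDeriv n (fun z => ((1 - (starRingEnd ℂ) lam * z) ^ m)⁻¹ • e) z =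
        ((a : ℂ) * (starRingEnd ℂ) lam ^ n * ((1 - (starRingEnd ℂ) lam * z) ^ (m + n))⁻¹) • e := by
  have hne : ∀ z : ℂ, ‖z‖ < 1 → 1 - (starRingEnd ℂ) lam * z ≠ 0 := fun z hz => by
    have := one_sub_ge (lam := lam) hz
    exact norm_pos_iff.1 (by linarith)
  induction n with
  | zero => exact ⟨1, le_rfl, fun z hz => by simp⟩
  | succ n ih =>
    obtain ⟨a, ha, h⟩ := ih
    refine ⟨a * (m + n), Nat.mul_pos ha (by omega), fun z hz => ?_⟩
    rw [iteratedDeriv_succ]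
    have hev : iteratedDeriv n (fun z => ((1 - (starRingEnd ℂ) lam * z) ^ m)⁻¹ • e) =ᶠ[nhds z]
        fun z => ((a : ℂ) * (starRingEnd ℂ) lam ^ n * ((1 - (starRingEnd ℂ) lam * z) ^ (m + n))⁻¹) • e := by
      have : ball (0:ℂ) 1 ∈ nhds z := isOpen_ball.mem_nhds (by simpa using hz)
      filter_upwards [this] with y hy
      exact h y (by simpa using hy)
    rw [hev.deriv_eq]
    have hz0 := hne z hz
    have h1 : HasDerivAt (fun z : ℂ => 1 - (starRingEnd ℂ) lam * z) (-(starRingEnd ℂ) lam) z := by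
      simpa using ((hasDerivAt_id z).const_mul ((starRingEnd ℂ) lam)).const_sub 1
    have h2 := (((h1.pow (m + n)).inv (pow_ne_zero _ hz0)).const_mul
      ((a : ℂ) * (starRingEnd ℂ) lam ^ n)).smul_const e
    refine h2.deriv.trans ?_
    congr 1
    obtain ⟨q, hq⟩ : ∃ q, m + n = q + 1 := ⟨m + n - 1, by omega⟩
    have hq' : m + (n + 1) = q + 2 := by omega
    have hq2 : m + n - 1 = q := by omega
    rw [hq']
    simp only [hq, Pi.pow_apply, add_tsub_cancel_right]
    push_cast
    field_simp
    ring

lemma re_smul (T : H →L[ℂ] H) (k : ℂ) (e : H) :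
    T.reApplyInnerSelf (k • e) = ‖k‖ ^ 2 * T.reApplyInnerSelf e :=
  T.reApplyInnerSelf_smul e

lemma unit_lower {T : H →L[ℂ] H} (hT : T.IsPositive) (hu : IsUnit T) :
    ∃ K : ℝ, 0 ≤ K ∧ ∀ e, ‖e‖ ^ 2 ≤ K * T.reApplyInnerSelf e := by
  obtain ⟨U, hU⟩ := hu
  obtain ⟨S, hS, hS2⟩ := pos_sqrt hT
  let V : H →L[ℂ] H := (U⁻¹ : (H →L[ℂ] H)ˣ)
  refine ⟨‖V ∘L S‖ ^ 2, by positivity, fun e => ?_⟩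
  have h1 : (V ∘L S) (S e) = e := by
    have : V * T = 1 := by rw [← hU]; exact U.inv_mul
    have h2 := congrArg (fun A : H →L[ℂ] H => A e) this
    rw [← hS2] at h2
    simpa using h2
  have h3 := (V ∘L S).le_opNorm (S e)
  rw [h1] at h3
  rw [← hS2, sqrt_re hS, ← mul_pow]
  gcongr

lemma far_case {η : ℝ} {r : ℝ} (hr1 : r < 1) {n : ℕ} {G W Winv : ℂ → H →L[ℂ] H}
    (hGpos : ∀ z : ℂ, ‖z‖ < 1 → (G z).IsPositive)
    (hGint : ∃ TG : H →L[ℂ] H, IsWeakOpIntegral areaM G (ball (0 : ℂ) 1) TG)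
    (hW : IsB2Weight η W Winv) {C : ℝ} (hC0 : 0 ≤ C)
    (hemb : ∀ f : ℂ → H, DifferentiableOn ℂ f (ball (0 : ℂ) 1) →
      Integrable (fun z => (W z).reApplyInnerSelf (f z)) (measAeta η) →
      ∫ z, (G z).reApplyInnerSelf (iteratedDeriv n f z) ∂areaM ≤
        C * ∫ z, (W z).reApplyInnerSelf (f z) ∂(measAeta η))
    {C1 : ℝ} (hC1 : 0 < C1) {N : ℕ}
    (H1 : ∀ lam : ℂ, ‖lam‖ < 1 → ∀ τ : ℝ, 3 * (1 - ‖lam‖) ≤ τ → ∀ e : H,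
      wMeas η W e (kBall lam τ) ≤
        ENNReal.ofReal (C1 * ((τ / (1 - ‖lam‖)) ^ N) ^ 2) * wMeas η W e (discAt lam r))
    (lam : ℂ) (hl : ‖lam‖ < 1) (hl2 : 1 / 2 ≤ ‖lam‖) (e : H) :
    ∫ z in discAt lam r, (G z).reApplyInnerSelf e ∂areaM ≤
      C * (C1 * 16 ^ N * 2) * (2 ^ n * 3 ^ (N + 1 + n)) ^ 2 * (1 - ‖lam‖) ^ (2 * n) *
        ∫ z in discAt lam r, (W z).reApplyInnerSelf e ∂(measAeta η) := by
  set δ := 1 - ‖lam‖ with hδ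
  have hδ0 : 0 < δ := by simp only [hδ]; linarith
  set m := N + 1 with hm
  obtain ⟨TG0, hTG0⟩ := hGint
  have hg : Integrable (fun z => (G z).reApplyInnerSelf e) areaM := by
    have := (re_eq_of_weak hTG0 e).1
    rwa [areaM_restrict] at this
  have hgnn : 0 ≤ᵐ[areaM] fun z => (G z).reApplyInnerSelf e := by
    filter_upwards [areaM_ball] with z hz
    exact (hGpos z (by simpa using hz)).re_inner_nonneg_left e
  have hw := B2_int hW e
  have hwnn := B2_nonneg hW e
  let k : ℂ → ℂ := fun z => ((1 - (starRingEnd ℂ) lam * z) ^ m)⁻¹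
  have hne : ∀ z : ℂ, ‖z‖ < 1 → 1 - (starRingEnd ℂ) lam * z ≠ 0 := fun z hz => by
    have := one_sub_ge (lam := lam) hz
    exact norm_pos_iff.1 (by linarith)
  have kn : ∀ z, ‖k z‖ ^ 2 = (‖1 - (starRingEnd ℂ) lam * z‖ ^ m)⁻¹ ^ 2 := fun z => by
    simp only [k, norm_inv, norm_pow]
  have hmeas : Measurable fun z => ‖k z‖ ^ 2 := by
    simp only [k]; fun_prop
  obtain ⟨a, ha, hder⟩ := kernel_deriv lam hl m (by omega) e n
  let kd : ℂ → ℂ := fun z => (a : ℂ) * (starRingEnd ℂ) lam ^ n *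
    ((1 - (starRingEnd ℂ) lam * z) ^ (m + n))⁻¹
  have kdn : ∀ z, ‖kd z‖ = a * ‖lam‖ ^ n * (‖1 - (starRingEnd ℂ) lam * z‖ ^ (m + n))⁻¹ := fun z => by
    simp only [kd, norm_mul, norm_inv, norm_pow, RCLike.norm_conj, Complex.norm_natCast]
  have hmeasd : Measurable fun z => ‖kd z‖ ^ 2 := by
    simp only [kd]; fun_prop
  -- integrability of the W side
  have hkw : Integrable (fun z => ‖k z‖ ^ 2 * (W z).reApplyInnerSelf e) (measAeta η) := by
    refine Integrable.bdd_mul (c := (δ ^ m)⁻¹ ^ 2) hw hmeas.aestronglyMeasurable ?_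
    filter_upwards [measAeta_ball η] with z hz
    rw [Real.norm_of_nonneg (by positivity), kn]
    have := one_sub_ge (lam := lam) (z := z) (by simpa using hz)
    gcongr
  have hkg : Integrable (fun z => ‖kd z‖ ^ 2 * (G z).reApplyInnerSelf e) areaM := by
    refine Integrable.bdd_mul (c := (a * ‖lam‖ ^ n * (δ ^ (m + n))⁻¹) ^ 2) hg
      hmeasd.aestronglyMeasurable ?_
    filter_upwards [areaM_ball] with z hz
    rw [Real.norm_of_nonneg (by positivity), kdn]
    have := one_sub_ge (lam := lam) (z := z) (by simpa using hz)
    gcongr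
  have hdiff : DifferentiableOn ℂ (fun z => k z • e) (ball (0:ℂ) 1) := by
    intro z hz
    have h0 := hne z (by simpa using hz)
    refine DifferentiableAt.differentiableWithinAt ?_
    simp only [k]
    have hd : DifferentiableAt ℂ (fun z : ℂ => (1 - (starRingEnd ℂ) lam * z) ^ m) z := by fun_prop
    exact (hd.fun_inv (pow_ne_zero _ h0)).smul_const e
  have main := hemb (fun z => k z • e) hdiff (by simpa only [re_smul] using hkw)
  have eG : ∫ z, (G z).reApplyInnerSelf (iteratedDeriv n (fun z => k z • e) z) ∂areaM =
      ∫ z, ‖kd z‖ ^ 2 * (G z).reApplyInnerSelf e ∂areaM := by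
    refine integral_congr_ae ?_
    filter_upwards [areaM_ball] with z hz
    rw [← re_smul]
    congr 1
    exact hder z (by simpa using hz)
  rw [eG] at main
  simp only [re_smul] at main
  -- W side bound
  have hIW : 0 ≤ ∫ z in discAt lam r, (W z).reApplyInnerSelf e ∂(measAeta η) :=
    integral_nonneg_of_ae (ae_restrict_of_ae hwnn)
  have hWside : ∫ z, ‖k z‖ ^ 2 * (W z).reApplyInnerSelf e ∂(measAeta η) ≤
      C1 * 16 ^ N * 2 * (δ ^ m)⁻¹ ^ 2 *
        ∫ z in discAt lam r, (W z).reApplyInnerSelf e ∂(measAeta η) := by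
    have h1 := kernel_int hC1 H1 lam hl e
    rw [wMeas_apply hW, ← ENNReal.ofReal_mul (by positivity)] at h1
    rw [← ENNReal.ofReal_le_ofReal_iff (by positivity)]
    refine le_trans (le_of_eq ?_) h1
    rw [ofReal_integral_eq_lintegral_ofReal hkw (by
      filter_upwards [hwnn] with z hz
      exact mul_nonneg (by positivity) hz)]
    unfold wMeas
    rw [lintegral_withDensity_eq_lintegral_mul₀ hw.1.aemeasurable.ennreal_ofReal
      (by fun_prop)]
    refine lintegral_congr fun z => ?_
    rw [Pi.mul_apply, ENNReal.ofReal_mul (sq_nonneg ‖k z‖), kn, mul_comm]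
  -- G side bound
  set κ : ℝ := ((1 / 2) ^ n * ((3 * δ) ^ (m + n))⁻¹) with hκ
  have hκ0 : 0 < κ := by positivity
  have hGside : κ ^ 2 * ∫ z in discAt lam r, (G z).reApplyInnerSelf e ∂areaM ≤
      ∫ z, ‖kd z‖ ^ 2 * (G z).reApplyInnerSelf e ∂areaM := by
    rw [← integral_const_mul]
    refine le_trans ?_ (setIntegral_le_integral (s := discAt lam r) hkg ?_)
    · refine integral_mono_ae (hg.restrict.const_mul _) hkg.restrict ?_
      have ms : MeasurableSet (discAt lam r) := by rw [disc_eq hl hr1]; exact measurableSet_ball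
      filter_upwards [ae_restrict_of_ae hgnn, ae_restrict_mem ms] with z hz hzD
      have hz0 : 0 ≤ (G z).reApplyInnerSelf e := hz
      have hb := (disc_bound hl hr1 hzD).le
      have hpos := norm_pos_iff.2 (hne z hzD.1)
      have : κ ≤ ‖kd z‖ := by
        rw [kdn, hκ]
        have ha' : (1:ℝ) ≤ a := by exact_mod_cast ha
        have h5 : (1 / 2 : ℝ) ^ n ≤ a * ‖lam‖ ^ n := by
          have : (1 / 2 : ℝ) ^ n ≤ ‖lam‖ ^ n := by gcongr
          nlinarith [pow_nonneg (norm_nonneg lam) n]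
        gcongr
      change κ ^ 2 * _ ≤ ‖kd z‖ ^ 2 * _
      gcongr
    · filter_upwards [hgnn] with z hz
      exact mul_nonneg (by positivity) hz
  have h7 : κ ^ 2 * ∫ z in discAt lam r, (G z).reApplyInnerSelf e ∂areaM ≤
      C * (C1 * 16 ^ N * 2 * (δ ^ m)⁻¹ ^ 2 *
        ∫ z in discAt lam r, (W z).reApplyInnerSelf e ∂(measAeta η)) :=
    (hGside.trans main).trans (mul_le_mul_of_nonneg_left hWside hC0)
  set IG := ∫ z in discAt lam r, (G z).reApplyInnerSelf e ∂areaM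
  set IW := ∫ z in discAt lam r, (W z).reApplyInnerSelf e ∂(measAeta η)
  have h8 : IG = (κ ^ 2)⁻¹ * (κ ^ 2 * IG) := by field_simp
  rw [h8]
  refine (mul_le_mul_of_nonneg_left h7 (by positivity)).trans (le_of_eq ?_)
  rw [hκ, one_div, inv_pow, mul_pow (3:ℝ) δ, pow_add δ, mul_comm 2 n, pow_mul δ]
  field_simp

lemma near_case {η : ℝ} {r : ℝ} {n : ℕ} {G W Winv : ℂ → H →L[ℂ] H}
    (hGpos : ∀ z : ℂ, ‖z‖ < 1 → (G z).IsPositive)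
    (hGint : ∃ TG : H →L[ℂ] H, IsWeakOpIntegral areaM G (ball (0 : ℂ) 1) TG)
    (hW : IsB2Weight η W Winv)
    {C1 : ℝ} (hC1 : 0 < C1) {N : ℕ}
    (H1 : ∀ lam : ℂ, ‖lam‖ < 1 → ∀ τ : ℝ, 3 * (1 - ‖lam‖) ≤ τ → ∀ e : H,
      wMeas η W e (kBall lam τ) ≤
        ENNReal.ofReal (C1 * ((τ / (1 - ‖lam‖)) ^ N) ^ 2) * wMeas η W e (discAt lam r)) :
    ∃ c : ℝ, 0 ≤ c ∧ ∀ lam : ℂ, ‖lam‖ < 1 / 2 → ∀ e : H,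
    ∫ z in discAt lam r, (G z).reApplyInnerSelf e ∂areaM ≤ c * (1 - ‖lam‖) ^ (2 * n) *
        ∫ z in discAt lam r, (W z).reApplyInnerSelf e ∂(measAeta η) := by
  obtain ⟨TG0, hTG0⟩ := hGint
  obtain ⟨TW0, hTW0, hTWu⟩ := hW.2.1
  have hTWre : ∀ e, TW0.reApplyInnerSelf e = ∫ z, (W z).reApplyInnerSelf e ∂(measAeta η) := fun e => by
    have := (re_eq_of_weak hTW0 e).2
    rwa [measAeta_restrict] at this
  have hTWp : TW0.IsPositive := by
    obtain ⟨P, hP, hPp⟩ := exists_weak ((B2_pos hW).mono fun z hz => hz.1) (measAeta_restrict η) hTW0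
      (ball (0:ℂ) 1)
    have : TW0 = P := by
      ext x
      refine ext_inner_right ℂ fun y => ?_
      rw [(hTW0 x y).2, (hP x y).2]
    rwa [this]
  obtain ⟨K, hK0, hK⟩ := unit_lower hTWp hTWu
  refine ⟨‖TG0‖ * K * (C1 * (6 ^ N) ^ 2) * 4 ^ n, by positivity, fun lam hl e => ?_⟩
  have hl1 : ‖lam‖ < 1 := by linarith
  set δ := 1 - ‖lam‖ with hδ
  have hδ0 : 1 / 2 ≤ δ := by simp only [hδ]; linarith
  have hδ1 : δ ≤ 1 := by simp only [hδ]; linarith [norm_nonneg lam]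
  have hg : Integrable (fun z => (G z).reApplyInnerSelf e) areaM := by
    have := (re_eq_of_weak hTG0 e).1
    rwa [areaM_restrict] at this
  have hgnn : 0 ≤ᵐ[areaM] fun z => (G z).reApplyInnerSelf e := by
    filter_upwards [areaM_ball] with z hz
    exact (hGpos z (by simpa using hz)).re_inner_nonneg_left e
  have hIW : 0 ≤ ∫ z in discAt lam r, (W z).reApplyInnerSelf e ∂(measAeta η) :=
    integral_nonneg_of_ae (ae_restrict_of_ae (B2_nonneg hW e))
  have s1 : ∫ z in discAt lam r, (G z).reApplyInnerSelf e ∂areaM ≤ ‖TG0‖ * ‖e‖ ^ 2 := by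
    refine (setIntegral_le_integral hg hgnn).trans ?_
    have := (re_eq_of_weak hTG0 e).2
    rw [areaM_restrict] at this
    rw [← this, ContinuousLinearMap.reApplyInnerSelf_apply]
    refine (RCLike.re_le_norm _).trans ((norm_inner_le_norm _ _).trans ?_)
    have := TG0.le_opNorm e
    nlinarith [norm_nonneg e]
  have s2 : ∫ z, (W z).reApplyInnerSelf e ∂(measAeta η) ≤ C1 * (6 ^ N) ^ 2 *
      ∫ z in discAt lam r, (W z).reApplyInnerSelf e ∂(measAeta η) := by
    have h1 := H1 lam hl1 3 (by linarith) e
    have h2 : wMeas η W e univ = wMeas η W e (kBall lam 3) := by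
      apply measure_congr
      filter_upwards [wMeas_ball e] with z hz
      apply propext
      refine ⟨fun _ => ⟨hz, ?_⟩, fun _ => trivial⟩
      refine (norm_sub_le _ _).trans_lt ?_
      rw [norm_one, norm_mul, RCLike.norm_conj]
      nlinarith [norm_nonneg lam, norm_nonneg z]
    rw [← h2, wMeas_apply hW, wMeas_apply hW, ← ENNReal.ofReal_mul (by positivity),
      ENNReal.ofReal_le_ofReal_iff (by positivity), setIntegral_univ] at h1
    refine h1.trans ?_
    have h6 : 3 / δ ≤ 6 := by rw [div_le_iff₀ (by linarith)]; linarith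
    gcongr
  have s3 : (1:ℝ) ≤ 4 ^ n * δ ^ (2 * n) := by
    rw [pow_mul, ← mul_pow]
    apply one_le_pow₀
    nlinarith
  set IW := ∫ z in discAt lam r, (W z).reApplyInnerSelf e ∂(measAeta η)
  have s4 := hK e
  rw [hTWre] at s4
  calc _ ≤ ‖TG0‖ * ‖e‖ ^ 2 := s1
    _ ≤ ‖TG0‖ * (K * (C1 * (6 ^ N) ^ 2 * IW)) := by
        refine mul_le_mul_of_nonneg_left (s4.trans ?_) (norm_nonneg _)
        exact mul_le_mul_of_nonneg_left s2 hK0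
    _ = ‖TG0‖ * (K * (C1 * (6 ^ N) ^ 2 * IW)) * 1 := by ring
    _ ≤ ‖TG0‖ * (K * (C1 * (6 ^ N) ^ 2 * IW)) * (4 ^ n * δ ^ (2 * n)) := by gcongr
    _ = _ := by ring

/-- Necessity in the Carleson embedding theorem (by testing on reproducing kernels):
if `∫ ⟨G f⁽ⁿ⁾, f⁽ⁿ⁾⟩ dA ≲ ∫ ⟨W f, f⟩ dA_η` for all `f ∈ L²_a(H, W dA_η)`, then
`∫_{D_{λ,r}} G dA ≲ (1−|λ|)^{2n} ∫_{D_{λ,r}} W dA_η` uniformly in `λ`. -/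
theorem carleson_embedding_necessity (η : ℝ) (hη : -1 < η) (r : ℝ) (hr : 0 < r)
    (hr1 : r < 1) (n : ℕ) (G W Winv : ℂ → H →L[ℂ] H)
    (hGpos : ∀ z : ℂ, ‖z‖ < 1 → (G z).IsPositive)
    (hGint : ∃ TG : H →L[ℂ] H, IsWeakOpIntegral areaM G (ball (0 : ℂ) 1) TG)
    (hW : IsB2Weight η W Winv) (C : ℝ)
    (hemb : ∀ f : ℂ → H, DifferentiableOn ℂ f (ball (0 : ℂ) 1) →
      Integrable (fun z => (W z).reApplyInnerSelf (f z)) (measAeta η) →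
      ∫ z, (G z).reApplyInnerSelf (iteratedDeriv n f z) ∂areaM ≤
        C * ∫ z, (W z).reApplyInnerSelf (f z) ∂(measAeta η)) :
    ∃ c : ℝ, ∀ lam : ℂ, ‖lam‖ < 1 → ∀ TG TW : H →L[ℂ] H,
      IsWeakOpIntegral areaM G (discAt lam r) TG →
      IsWeakOpIntegral (measAeta η) W (discAt lam r) TW →
      ∀ e : H, TG.reApplyInnerSelf e ≤ c * (1 - ‖lam‖) ^ (2 * n) * TW.reApplyInnerSelf e := by
  obtain ⟨C1, hC1, N, H1⟩ := B2_doubling hη hr hr1 hW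
  obtain ⟨c2, hc2, hnear⟩ := near_case (n := n) hGpos hGint hW hC1 H1
  have hemb' : ∀ f : ℂ → H, DifferentiableOn ℂ f (ball (0 : ℂ) 1) →
      Integrable (fun z => (W z).reApplyInnerSelf (f z)) (measAeta η) →
      ∫ z, (G z).reApplyInnerSelf (iteratedDeriv n f z) ∂areaM ≤
        (max C 0) * ∫ z, (W z).reApplyInnerSelf (f z) ∂(measAeta η) := by
    intro f hf hi
    refine (hemb f hf hi).trans (mul_le_mul_of_nonneg_right (le_max_left _ _) ?_)
    refine integral_nonneg_of_ae ?_
    filter_upwards [B2_pos hW] with z hz using hz.1.re_inner_nonneg_left _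
  have hfar := far_case hr1 hGpos hGint hW (le_max_right C 0) hemb' hC1 H1
  set c1 := (max C 0) * (C1 * 16 ^ N * 2) * (2 ^ n * 3 ^ (N + 1 + n)) ^ 2 with hc1d
  have hc1 : 0 ≤ c1 := by
    have := le_max_right C 0
    positivity
  refine ⟨c1 + c2, fun lam hl TG TW hTG hTW e => ?_⟩
  rw [(re_eq_of_weak hTG e).2, (re_eq_of_weak hTW e).2]
  have hIW : 0 ≤ ∫ z in discAt lam r, (W z).reApplyInnerSelf e ∂(measAeta η) :=
    integral_nonneg_of_ae (ae_restrict_of_ae (B2_nonneg hW e))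
  have hd : 0 ≤ (1 - ‖lam‖) ^ (2 * n) := pow_nonneg (by linarith) _
  have hp := mul_nonneg hd hIW
  rcases le_or_gt (1 / 2) ‖lam‖ with h | h
  · have h3 := hfar lam hl h e
    nlinarith [mul_nonneg hc2 hp]
  · have h3 := hnear lam h e
    nlinarith [mul_nonneg hc1 hp]
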